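/- Let A₁₁ and A₁₂ be commuting real symmetric M×M matrices with common orthonormal eigenbasis v₁,…,v_M, A₁₁ v_k = f_k v_k, A₁₂ v_k = h_k v_k, and let A = [[A₁₁, A₁₂],[A₁₂, A₁₁]]. Let c > 0 satisfy c|h_k + f_k| < 1 and c|h_k − f_k| < 1 for all k. Then the spectrum, with multiplicity, of the matrix Z_{2M} σ_{cA} is the multiset {+ν_k : k = 1,…,M} ∪ {−ν_k : k = 1,…,M}, where ν_k = (1/2)·√(((1 + c h_k)² − c² f_k²)/((1 − c h_k)² − c² f_k²)). -/

import Mathlib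

open Matrix Polynomial

/-- The determinant of a two-by-two block matrix with diagonal blocks. -/
theorem det_fromBlocks_diagonal {n R : Type*} [Fintype n] [DecidableEq n] [CommRing R]
    (a b c d : n → R) :
    (Matrix.fromBlocks (diagonal a) (diagonal b) (diagonal c) (diagonal d)).det =
      ∏ k, (a k * d k - b k * c k) := by
  have key : Matrix.fromBlocks (diagonal a) (diagonal b) (diagonal c) (diagonal d) =
      (blockDiagonal fun k => !![a k, b k; c k, d k]).submatrix
        ((Equiv.boolProdEquivSum n).symm.trans (finTwoEquiv.symm.prodCongr (Equiv.refl n)))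
        ((Equiv.boolProdEquivSum n).symm.trans (finTwoEquiv.symm.prodCongr (Equiv.refl n))) := by
    ext (i | i) (j | j) <;>
      simp [blockDiagonal_apply, diagonal_apply, Equiv.boolProdEquivSum, finTwoEquiv]
  rw [key, det_submatrix_equiv_self, det_blockDiagonal]
  simp [det_fin_two]

/-- The characteristic polynomial of a two-by-two block matrix with diagonal blocks. -/
theorem charpoly_fromBlocks_diagonal {n R : Type*} [Fintype n] [DecidableEq n] [CommRing R]
    (a b c d : n → R) :
    (Matrix.fromBlocks (diagonal a) (diagonal b) (diagonal c) (diagonal d)).charpoly =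
      ∏ k, ((X - C (a k)) * (X - C (d k)) - C (b k) * C (c k)) := by
  have key : (Matrix.fromBlocks (diagonal a) (diagonal b) (diagonal c) (diagonal d)).charmatrix =
      Matrix.fromBlocks (diagonal fun k => X - C (a k)) (diagonal fun k => -C (b k))
        (diagonal fun k => -C (c k)) (diagonal fun k => X - C (d k)) := by
    rw [charmatrix_fromBlocks]
    congr 1 <;> ext i j : 1 <;> by_cases hij : i = j <;> simp [hij]
  rw [charpoly, key, det_fromBlocks_diagonal]
  simp

/-- A square matrix whose columns are eigenvectors of `A` intertwines `A` with the diagonal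
matrix of the eigenvalues. -/
theorem mul_transpose_of_eq_mul_diagonal {n R : Type*} [Fintype n] [DecidableEq n] [CommRing R]
    {A : Matrix n n R} {v : n → n → R} {f : n → R} (hf : ∀ k, A *ᵥ v k = f k • v k) :
    A * (Matrix.of v)ᵀ = (Matrix.of v)ᵀ * diagonal f := by
  ext i k
  rw [mul_diagonal]
  simpa [mul_comm, mulVec, mul_apply, dotProduct] using congrFun (hf k) i

theorem stmt_6 (M : ℕ) (A11 A12 : Matrix (Fin M) (Fin M) ℝ)
    (h11 : A11.IsSymm) (h12 : A12.IsSymm) (hcomm : A11 * A12 = A12 * A11)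
    (v : Fin M → Fin M → ℝ)
    (horth : ∀ k l, v k ⬝ᵥ v l = if k = l then (1 : ℝ) else 0)
    (f h : Fin M → ℝ)
    (hf : ∀ k, A11 *ᵥ v k = f k • v k)
    (hh : ∀ k, A12 *ᵥ v k = h k • v k)
    (c : ℝ) (hc : 0 < c)
    (hc1 : ∀ k, c * |h k + f k| < 1)
    (hc2 : ∀ k, c * |h k - f k| < 1)
    (ν : Fin M → ℝ)
    (hν : ∀ k, ν k = (1 / 2) * Real.sqrt
      (((1 + c * h k) ^ 2 - c ^ 2 * (f k) ^ 2) / ((1 - c * h k) ^ 2 - c ^ 2 * (f k) ^ 2))) :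
    ((Matrix.fromBlocks 1 0 0 (-1) : Matrix (Fin M ⊕ Fin M) (Fin M ⊕ Fin M) ℝ) *
      (((1 : Matrix (Fin M ⊕ Fin M) (Fin M ⊕ Fin M) ℝ) -
          Matrix.fromBlocks 0 1 1 0 * (c • Matrix.fromBlocks A11 A12 A12 A11))⁻¹ -
        (1 / 2 : ℝ) • (1 : Matrix (Fin M ⊕ Fin M) (Fin M ⊕ Fin M) ℝ))).charpoly =
      ∏ k : Fin M, ((X - C (ν k)) * (X - C (-ν k))) := by
  have hpos : ∀ k, 0 < 1 - c * h k - c * f k ∧ 0 < 1 - c * h k + c * f k ∧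
      0 < 1 + c * h k + c * f k ∧ 0 < 1 + c * h k - c * f k := by
    intro k
    have h1 := hc1 k
    have h2 := hc2 k
    rw [← abs_of_pos hc, ← abs_mul, abs_lt] at h1 h2
    refine ⟨?_, ?_, ?_, ?_⟩ <;> linarith [h1.1, h1.2, h2.1, h2.2]
  set P : Matrix (Fin M) (Fin M) ℝ := (Matrix.of v)ᵀ with hP
  have hPP : Pᵀ * P = 1 := by
    ext k l
    simpa [hP, mul_apply, dotProduct, one_apply] using horth k l
  have hAP : A11 * P = P * diagonal f := mul_transpose_of_eq_mul_diagonal hf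
  have hBP : A12 * P = P * diagonal h := mul_transpose_of_eq_mul_diagonal hh
  set Q : Matrix (Fin M ⊕ Fin M) (Fin M ⊕ Fin M) ℝ := Matrix.fromBlocks P 0 0 P with hQ
  have hQQ : Qᵀ * Q = 1 := by
    simp [hQ, fromBlocks_transpose, fromBlocks_multiply, hPP]
  have hQQ' : Q * Qᵀ = 1 := mul_eq_one_comm.mp hQQ
  set Z : Matrix (Fin M ⊕ Fin M) (Fin M ⊕ Fin M) ℝ := Matrix.fromBlocks 1 0 0 (-1) with hZ
  set B : Matrix (Fin M ⊕ Fin M) (Fin M ⊕ Fin M) ℝ :=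
    1 - Matrix.fromBlocks 0 1 1 0 * (c • Matrix.fromBlocks A11 A12 A12 A11) with hB
  let a : Fin M → ℝ := fun k => 1 - c * h k
  let b : Fin M → ℝ := fun k => c * f k
  let δ : Fin M → ℝ := fun k => a k ^ 2 - b k ^ 2
  have hδ : ∀ k, 0 < δ k := fun k => by
    have := mul_pos (hpos k).1 (hpos k).2.1
    simp only [δ, a, b]
    linarith
  let D : Matrix (Fin M ⊕ Fin M) (Fin M ⊕ Fin M) ℝ :=
    Matrix.fromBlocks (diagonal a) (diagonal (-b)) (diagonal (-b)) (diagonal a)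
  let D' : Matrix (Fin M ⊕ Fin M) (Fin M ⊕ Fin M) ℝ :=
    Matrix.fromBlocks (diagonal fun k => a k / δ k) (diagonal fun k => b k / δ k)
      (diagonal fun k => b k / δ k) (diagonal fun k => a k / δ k)
  have hBQ : B * Q = Q * D := by
    have ha : diagonal a = 1 - c • diagonal h := by
      ext i j
      by_cases hij : i = j <;> simp [a, hij]
    have hb : diagonal (-b) = -(c • diagonal f) := by
      ext i j
      by_cases hij : i = j <;> simp [b, hij]
    simp only [hB, hQ, D, ha, hb, sub_mul, one_mul, fromBlocks_smul, fromBlocks_multiply]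
    simp [hAP, hBP, sub_eq_add_neg, fromBlocks_neg, fromBlocks_add,
      mul_add]
  have hDD : D * D' = 1 := by
    simp only [D, D', fromBlocks_multiply, diagonal_mul_diagonal, diagonal_add]
    rw [← fromBlocks_one, ← diagonal_one, ← diagonal_zero]
    congr 2 <;> ext k <;> have := (hδ k).ne' <;> simp only [Pi.neg_apply] <;> field_simp <;>
      simp only [δ] <;> ring
  have hinv : B⁻¹ = Q * D' * Qᵀ := by
    refine inv_eq_right_inv ?_
    calc B * (Q * D' * Qᵀ) = B * Q * D' * Qᵀ := by simp only [Matrix.mul_assoc]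
      _ = Q * (D * D') * Qᵀ := by rw [hBQ]; simp only [Matrix.mul_assoc]
      _ = 1 := by rw [hDD, Matrix.mul_one, hQQ']
  have hZQ : Z * Q = Q * Z := by
    simp [hZ, hQ, fromBlocks_multiply]
  have hconj : Z * (B⁻¹ - (1 / 2 : ℝ) • 1) = Q * (Z * (D' - (1 / 2 : ℝ) • 1) * Qᵀ) := by
    rw [hinv]
    calc Z * (Q * D' * Qᵀ - (1 / 2 : ℝ) • 1)
        = Z * (Q * D' * Qᵀ - (1 / 2 : ℝ) • (Q * Qᵀ)) := by rw [hQQ']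
      _ = Z * Q * ((D' - (1 / 2 : ℝ) • 1) * Qᵀ) := by
        simp [Matrix.mul_assoc, Matrix.mul_sub, Matrix.sub_mul]
      _ = _ := by rw [hZQ]; simp only [Matrix.mul_assoc]
  have hE : Z * (D' - (1 / 2 : ℝ) • 1) =
      Matrix.fromBlocks (diagonal fun k => a k / δ k - 1 / 2) (diagonal fun k => b k / δ k)
        (diagonal fun k => -(b k / δ k)) (diagonal fun k => -(a k / δ k - 1 / 2)) := by
    ext (i | i) (j | j) <;> by_cases hij : i = j <;>
      simp [hZ, D', ← fromBlocks_one, sub_eq_add_neg, fromBlocks_smul, fromBlocks_neg,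
        fromBlocks_add, fromBlocks_multiply, hij]
  rw [hconj, charpoly_mul_comm, Matrix.mul_assoc, hQQ, Matrix.mul_one, hE,
    charpoly_fromBlocks_diagonal]
  refine Finset.prod_congr rfl fun k _ => ?_
  have hsq : ν k * ν k = (a k / δ k - 1 / 2) ^ 2 - (b k / δ k) ^ 2 := by
    obtain ⟨-, -, h3, h4⟩ := hpos k
    have hden : (1 - c * h k) ^ 2 - c ^ 2 * f k ^ 2 = δ k := by
      simp only [δ, a, b]
      ring
    have hnum : 0 ≤ (1 + c * h k) ^ 2 - c ^ 2 * f k ^ 2 := by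
      linarith [mul_pos h3 h4]
    rw [hν, mul_mul_mul_comm, hden, Real.mul_self_sqrt (div_nonneg hnum (hδ k).le)]
    have := (hδ k).ne'
    field_simp
    simp only [δ, a, b]
    ring
  have hC : C (ν k) * C (ν k) = C (a k / δ k - 1 / 2) ^ 2 - C (b k / δ k) ^ 2 := by
    rw [← C_mul, hsq, C_sub, C_pow, C_pow]
  rw [C_neg, C_neg, C_neg]
  linear_combination hC
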